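/- (Theorem 2, convergence to stationarity) Let S be symmetric and define F(L) = Tr(L S) − log det(L + J) + ρ_MCP(L; λ). Suppose sequences L^{(t)} ∈ F with det(L^{(t)} + J) > 0, symmetric matrices Δ^{(t)}, p²×p² symmetric matrices M^{(t)} with λ_min I ⪯ M^{(t)} ⪯ λ_max I and λ_min > 1/γ, and step sizes α_t ∈ [α_min, 1] with α_min > 0, satisfy for all t: (i) Δ^{(t)} is a global minimizer of the quadratic model G_t(Δ) = Tr(Δ(S − Q_t)) + (1/2) vec(Δ)^T M^{(t)} vec(Δ) + ρ_MCP(L^{(t)} + Δ; λ) over { Δ symmetric : L^{(t)} + Δ ∈ F }, where Q_t = (L^{(t)} + J)^{-1}; (ii) L^{(t+1)} = L^{(t)} + α_t Δ^{(t)}; and (iii) the sufficient decrease F(L^{(t+1)}) ≤ F(L^{(t)}) − c ‖Δ^{(t)}‖_F² holds for a fixed constant c > 0. Then every limit point L̄ of the sequence {L^{(t)}} with det(L̄ + J) > 0 is a stationary point of F on F, in the sense that for every symmetric D with L̄ + D ∈ F, liminf_{t→0⁺} (F(L̄ + tD) − F(L̄))/t ≥ 0. -/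

import Mathlib

open Matrix BigOperators Topology Filter

/-- The `p × p` matrix all of whose entries are `1/p`. -/
noncomputable def matJ (p : ℕ) : Matrix (Fin p) (Fin p) ℝ :=
  Matrix.of fun _ _ => (1 : ℝ) / p

/-- The set `F` of real symmetric `p × p` matrices with nonpositive off-diagonal
entries and zero row sums. -/
def setF (p : ℕ) : Set (Matrix (Fin p) (Fin p) ℝ) :=
  {L | L.IsSymm ∧ (∀ i j, i ≠ j → L i j ≤ 0) ∧ ∀ i, ∑ j, L i j = 0}

/-- The scalar minimax concave penalty `MCP(x; γ, λ)`. -/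
noncomputable def MCP (γ lam x : ℝ) : ℝ :=
  if |x| ≤ γ * lam then lam * |x| - x ^ 2 / (2 * γ) else γ * lam ^ 2 / 2

/-- The MCP penalty of a matrix: the sum of `MCP` over all off-diagonal entries. -/
noncomputable def rhoMCP {p : ℕ} (γ lam : ℝ) (L : Matrix (Fin p) (Fin p) ℝ) : ℝ :=
  ∑ i, ∑ j ∈ Finset.univ.filter (fun j => j ≠ i), MCP γ lam (L i j)

/-- Column-stacking of a `p × p` matrix into a vector indexed by `Fin p × Fin p`. -/
def vecM {p : ℕ} (Δ : Matrix (Fin p) (Fin p) ℝ) : Fin p × Fin p → ℝ :=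
  fun q => Δ q.1 q.2

/-- The penalized negative log-likelihood objective
`F(L) = Tr(L S) − log det (L + J) + ρ_MCP(L; λ)`. -/
noncomputable def objF {p : ℕ} (γ lam : ℝ) (S L : Matrix (Fin p) (Fin p) ℝ) : ℝ :=
  (L * S).trace - Real.log (L + matJ p).det + rhoMCP γ lam L

theorem MCP_eq_min {γ lam : ℝ} (hγ : 0 < γ) (x : ℝ) :
    MCP γ lam x = lam * min |x| (γ * lam) - (min |x| (γ * lam)) ^ 2 / (2 * γ) := by
  unfold MCP
  split_ifs with h
  · rw [min_eq_left h, sq_abs]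
  · rw [min_eq_right (not_le.mp h).le]
    field_simp
    ring

theorem continuous_MCP {γ lam : ℝ} (hγ : 0 < γ) : Continuous (MCP γ lam) := by
  rw [funext (MCP_eq_min (lam := lam) hγ)]
  fun_prop

theorem MCP_sub_le {γ lam : ℝ} (hγ : 0 < γ) (hlam : 0 ≤ lam) (x y : ℝ) :
    MCP γ lam x - MCP γ lam y ≤ lam * |x - y| := by
  rw [MCP_eq_min hγ, MCP_eq_min hγ]
  have hxy : |min |x| (γ * lam) - min |y| (γ * lam)| ≤ |x - y| :=
    (abs_min_sub_min_le_max _ _ _ _).trans (by simpa using abs_abs_sub_abs_le_abs_sub x y)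
  have ha0 : 0 ≤ min |x| (γ * lam) := by positivity
  have hb0 : 0 ≤ min |y| (γ * lam) := by positivity
  have ha : min |x| (γ * lam) ≤ γ * lam := min_le_right _ _
  have hb : min |y| (γ * lam) ≤ γ * lam := min_le_right _ _
  generalize min |x| (γ * lam) = a at *
  generalize min |y| (γ * lam) = b at *
  have hfac : lam * a - a ^ 2 / (2 * γ) - (lam * b - b ^ 2 / (2 * γ)) =
      (lam - (a + b) / (2 * γ)) * (a - b) := by
    field_simp
    ring
  have hslope : 0 ≤ lam - (a + b) / (2 * γ) := by
    rw [sub_nonneg, div_le_iff₀ (by positivity)]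
    linarith
  rw [hfac]
  calc (lam - (a + b) / (2 * γ)) * (a - b)
      ≤ (lam - (a + b) / (2 * γ)) * |x - y| :=
        mul_le_mul_of_nonneg_left ((le_abs_self _).trans hxy) hslope
    _ ≤ lam * |x - y| := by
        gcongr
        exact sub_le_self _ (by positivity)

theorem continuous_rhoMCP {p : ℕ} {γ lam : ℝ} (hγ : 0 < γ) :
    Continuous (rhoMCP γ lam : Matrix (Fin p) (Fin p) ℝ → ℝ) := by
  unfold rhoMCP
  exact continuous_finsetSum _ fun i _ => continuous_finsetSum _ fun j _ =>
    (continuous_MCP hγ).comp (continuous_id.matrix_elem i j)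

theorem rhoMCP_sub_le {p : ℕ} {γ lam : ℝ} (hγ : 0 < γ) (hlam : 0 ≤ lam)
    (A B : Matrix (Fin p) (Fin p) ℝ) :
    rhoMCP γ lam A - rhoMCP γ lam B ≤
      ∑ i, ∑ j ∈ Finset.univ.filter (fun j => j ≠ i), lam * |A i j - B i j| := by
  unfold rhoMCP
  simp only [← Finset.sum_sub_distrib]
  exact Finset.sum_le_sum fun i _ => Finset.sum_le_sum fun j _ => MCP_sub_le hγ hlam _ _

theorem isClosed_setF (p : ℕ) : IsClosed (setF p) := by
  have h : setF p = {L | Lᵀ = L} ∩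
      ({L | ∀ i j, i ≠ j → L i j ≤ 0} ∩ {L | ∀ i, ∑ j, L i j = 0}) := rfl
  rw [h]
  refine (isClosed_eq (by fun_prop) continuous_id).inter (IsClosed.inter ?_ ?_)
  · simp only [Set.ofPred_forall]
    exact isClosed_iInter fun i => isClosed_iInter fun j => isClosed_iInter fun _ =>
      isClosed_le (continuous_id.matrix_elem i j) continuous_const
  · simp only [Set.ofPred_forall]
    exact isClosed_iInter fun i => isClosed_eq
      (continuous_finsetSum _ fun j _ => continuous_id.matrix_elem i j) continuous_const

theorem convex_setF (p : ℕ) : Convex ℝ (setF p) := by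
  rintro A ⟨hAs, hA, hA0⟩ B ⟨hBs, hB, hB0⟩ a b ha hb -
  refine ⟨(hAs.smul a).add (hBs.smul b), fun i j hij => ?_, fun i => ?_⟩
  · have h₁ := mul_nonneg ha (neg_nonneg.mpr (hA i j hij))
    have h₂ := mul_nonneg hb (neg_nonneg.mpr (hB i j hij))
    simp only [Matrix.add_apply, Matrix.smul_apply, smul_eq_mul]
    linarith
  · simp [Finset.sum_add_distrib, ← Finset.mul_sum, hA0, hB0]

theorem continuousAt_matrix_inv_of_det_ne_zero {n : Type*} [Fintype n] [DecidableEq n]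
    {A : Matrix n n ℝ} (hA : A.det ≠ 0) : ContinuousAt Inv.inv A :=
  continuousAt_matrix_inv A (by simpa [Ring.inverse_eq_inv'] using continuousAt_inv₀ hA)

theorem hasDerivAt_log_det_add_smul {n : Type*} [Fintype n] [DecidableEq n]
    {A : Matrix n n ℝ} (hA : A.det ≠ 0) (D : Matrix n n ℝ) :
    HasDerivAt (fun t : ℝ => Real.log (A + t • D).det) (A⁻¹ * D).trace 0 := by
  obtain ⟨P, hP⟩ : ∃ P : Polynomial ℝ, ∀ t : ℝ,
      (A + t • D).det = A.det * (1 + (A⁻¹ * D).trace * t + P.eval t * t ^ 2) :=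
    ⟨_, fun t => by
      rw [← Matrix.det_one_add_smul, ← Matrix.det_mul, Matrix.mul_add, Matrix.mul_one,
        Matrix.mul_smul, Matrix.mul_nonsing_inv_cancel_left _ _ hA.isUnit]⟩
  simp only [hP]
  have h₁ : HasDerivAt (fun t : ℝ => A.det * (1 + (A⁻¹ * D).trace * t + P.eval t * t ^ 2))
      (A.det * (A⁻¹ * D).trace) 0 := by
    have h := ((((hasDerivAt_id (0 : ℝ)).const_mul (A⁻¹ * D).trace).const_add 1).add
      ((P.hasDerivAt 0).mul (hasDerivAt_pow 2 (0 : ℝ)))).const_mul A.det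
    refine (h.congr_deriv ?_).congr_of_eventuallyEq (Eventually.of_forall fun t => ?_)
    · simp
    · simp
  have h₂ := h₁.log (by simpa using hA)
  convert h₂ using 1
  simp [hA]

theorem continuousAt_objF {p : ℕ} {γ lam : ℝ} (hγ : 0 < γ) (S : Matrix (Fin p) (Fin p) ℝ)
    {L : Matrix (Fin p) (Fin p) ℝ} (hL : (L + matJ p).det ≠ 0) :
    ContinuousAt (objF γ lam S) L := by
  unfold objF
  have hdet : ContinuousAt (fun L : Matrix (Fin p) (Fin p) ℝ => (L + matJ p).det) L :=
    Continuous.continuousAt (by fun_prop)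
  have htr : ContinuousAt (fun L : Matrix (Fin p) (Fin p) ℝ => (L * S).trace) L :=
    Continuous.continuousAt (by fun_prop)
  exact (htr.sub (hdet.log hL)).add (continuous_rhoMCP hγ).continuousAt

/-- If `g` is antitone with a subsequence converging to a limit and `d` is dominated by the
decrements of `g`, then `d` tends to zero. -/
theorem tendsto_zero_of_le_sub_succ {g d : ℕ → ℝ} (hd : ∀ t, 0 ≤ d t)
    (hdec : ∀ t, g (t + 1) ≤ g t - d t) {φ : ℕ → ℕ} (hφ : Tendsto φ atTop atTop) {l : ℝ}
    (hl : Tendsto (g ∘ φ) atTop (𝓝 l)) : Tendsto d atTop (𝓝 0) := by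
  have hanti : Antitone g := antitone_nat_of_succ_le fun t => by linarith [hd t, hdec t]
  have hg : Tendsto g atTop (𝓝 l) := (tendsto_iff_tendsto_subseq_of_antitone hanti hφ).mpr hl
  have hdiff : Tendsto (fun t => g t - g (t + 1)) atTop (𝓝 0) := by
    simpa using hg.sub (hg.comp (tendsto_add_atTop_nat 1))
  exact squeeze_zero hd (fun t => by linarith [hdec t]) hdiff

theorem tendsto_zero_of_tendsto_sum_sq {m n ι : Type*} [Fintype m] [Fintype n] {l : Filter ι}
    {A : ι → Matrix m n ℝ} (h : Tendsto (fun t => ∑ i, ∑ j, A t i j ^ 2) l (𝓝 0)) :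
    Tendsto A l (𝓝 0) := by
  refine tendsto_pi_nhds.mpr fun i => tendsto_pi_nhds.mpr fun j => ?_
  have hsq : Tendsto (fun t => A t i j ^ 2) l (𝓝 0) :=
    squeeze_zero (fun t => sq_nonneg _) (fun t =>
      (Finset.single_le_sum (f := fun j => A t i j ^ 2) (fun _ _ => sq_nonneg _)
        (Finset.mem_univ j)).trans
      (Finset.single_le_sum (f := fun i => ∑ j, A t i j ^ 2)
        (fun _ _ => Finset.sum_nonneg fun _ _ => sq_nonneg _) (Finset.mem_univ i))) h
  have habs := hsq.sqrt
  simp only [Real.sqrt_sq_eq_abs, Real.sqrt_zero] at habs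
  exact (tendsto_zero_iff_abs_tendsto_zero _).mpr habs

theorem quadForm_nonneg_of_lower_bound {n : Type*} [Fintype n] [DecidableEq n]
    {M : Matrix n n ℝ} {a : ℝ} (ha : 0 ≤ a) (h : (M - a • (1 : Matrix n n ℝ)).PosSemidef)
    (x : n → ℝ) : 0 ≤ x ⬝ᵥ M *ᵥ x := by
  have h₁ := h.dotProduct_mulVec_nonneg x
  simp only [star_trivial, Matrix.sub_mulVec, Matrix.smul_mulVec, Matrix.one_mulVec,
    dotProduct_sub, dotProduct_smul, smul_eq_mul] at h₁
  have h₂ : 0 ≤ x ⬝ᵥ x := by simpa using dotProduct_star_self_nonneg x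
  nlinarith

theorem quadForm_le_of_upper_bound {n : Type*} [Fintype n] [DecidableEq n]
    {M : Matrix n n ℝ} {b : ℝ} (h : (b • (1 : Matrix n n ℝ) - M).PosSemidef)
    (x : n → ℝ) : x ⬝ᵥ M *ᵥ x ≤ b * (x ⬝ᵥ x) := by
  have h₁ := h.dotProduct_mulVec_nonneg x
  simp only [star_trivial, Matrix.sub_mulVec, Matrix.smul_mulVec, Matrix.one_mulVec,
    dotProduct_sub, dotProduct_smul, smul_eq_mul] at h₁
  linarith

/-- If every small step along `D` satisfies the limiting model inequality with quadratic
constant `b`, then `L` is a directional stationary point along `D`. -/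
theorem liminf_objF_nonneg_of_model {p : ℕ} {γ lam : ℝ} (hγ : 0 < γ) (hlam : 0 ≤ lam)
    (S : Matrix (Fin p) (Fin p) ℝ) {L D : Matrix (Fin p) (Fin p) ℝ}
    (hL : (L + matJ p).det ≠ 0) {b : ℝ}
    (hmodel : ∀ s : ℝ, 0 < s → s ≤ 1 → rhoMCP γ lam L ≤
      s * (D * (S - (L + matJ p)⁻¹)).trace + b * s ^ 2 + rhoMCP γ lam (L + s • D)) :
    0 ≤ Filter.liminf
      (fun t : ℝ => (objF γ lam S (L + t • D) - objF γ lam S L) / t) (𝓝[>] (0 : ℝ)) := by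
  set Q := (L + matJ p)⁻¹ with hQ
  have hlog : Tendsto (fun t : ℝ => (Real.log (L + matJ p + t • D).det -
      Real.log (L + matJ p).det) / t) (𝓝[>] 0) (𝓝 (Q * D).trace) := by
    have h := (hasDerivAt_log_det_add_smul hL D).tendsto_slope_zero_right
    refine h.congr fun t => ?_
    simp [div_eq_inv_mul]
  have hquot : ∀ t : ℝ, 0 < t → (objF γ lam S (L + t • D) - objF γ lam S L) / t =
      (D * S).trace - (Real.log (L + matJ p + t • D).det - Real.log (L + matJ p).det) / t +
        (rhoMCP γ lam (L + t • D) - rhoMCP γ lam L) / t := fun t ht => by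
    have hadd : L + t • D + matJ p = L + matJ p + t • D := by abel
    unfold objF
    rw [hadd, Matrix.add_mul, Matrix.smul_mul, Matrix.trace_add, Matrix.trace_smul, smul_eq_mul]
    field_simp
    ring
  have hpos : ∀ᶠ t : ℝ in 𝓝[>] 0, 0 < t := self_mem_nhdsWithin
  have hle_one : ∀ᶠ t : ℝ in 𝓝[>] 0, t ≤ 1 :=
    eventually_nhdsWithin_of_eventually_nhds (eventually_le_nhds one_pos)
  have hcobdd : (𝓝[>] (0 : ℝ)).IsCoboundedUnder (· ≥ ·)
      (fun t : ℝ => (objF γ lam S (L + t • D) - objF γ lam S L) / t) := by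
    have hlb : ∀ᶠ t : ℝ in 𝓝[>] 0, (Q * D).trace - 1 < (Real.log (L + matJ p + t • D).det -
        Real.log (L + matJ p).det) / t := hlog.eventually (lt_mem_nhds (sub_one_lt _))
    refine isCoboundedUnder_ge_of_eventually_le (𝓝[>] (0 : ℝ))
      (x := (D * S).trace - ((Q * D).trace - 1) +
        ∑ i, ∑ j ∈ Finset.univ.filter (fun j => j ≠ i), lam * |D i j|) ?_
    filter_upwards [hlb, hpos] with t hlt ht
    have hrho := rhoMCP_sub_le hγ hlam (L + t • D) L
    simp only [Matrix.add_apply, Matrix.smul_apply, smul_eq_mul, add_sub_cancel_left, abs_mul,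
      abs_of_pos ht, mul_left_comm lam t, ← Finset.mul_sum] at hrho
    rw [hquot t ht]
    have := (div_le_iff₀' ht).mpr hrho
    simp only [← Finset.mul_sum]
    linarith
  refine le_of_forall_lt fun a ha => ?_
  obtain ⟨a', haa', ha'⟩ := exists_between ha
  refine haa'.trans_le (le_liminf_of_le hcobdd ?_)
  have hlower : Tendsto (fun t : ℝ => (Q * D).trace - (Real.log (L + matJ p + t • D).det -
      Real.log (L + matJ p).det) / t - b * t) (𝓝[>] 0) (𝓝 0) := by
    have ht : Tendsto (fun t : ℝ => b * t) (𝓝[>] 0) (𝓝 (b * 0)) :=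
      ((continuous_const_mul b).tendsto 0).mono_left nhdsWithin_le_nhds
    simpa using (hlog.const_sub (Q * D).trace).sub ht
  filter_upwards [hlower.eventually (lt_mem_nhds ha'), hpos, hle_one] with t hat ht ht1
  rw [hquot t ht]
  have hm := hmodel t ht ht1
  rw [Matrix.mul_sub, Matrix.trace_sub, Matrix.trace_mul_comm D Q] at hm
  have hdiv : -((D * S).trace - (Q * D).trace) - b * t ≤
      (rhoMCP γ lam (L + t • D) - rhoMCP γ lam L) / t := by
    rw [le_div_iff₀ ht]
    linarith
  linarith

/-- Theorem 2, convergence to stationarity: under the proximal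
quadratic minimization iterations with bounded Hessian approximations, linesearch
steps bounded away from zero, and sufficient decrease, every limit point `L̄` of
the iterates with `det(L̄ + J) > 0` is a directional stationary point of `F` on `F`. -/
theorem convergence_to_stationary (p : ℕ) (hp : 2 ≤ p) (γ lam : ℝ)
    (hγ : 0 < γ) (hlam : 0 ≤ lam) (S : Matrix (Fin p) (Fin p) ℝ) (hS : S.IsSymm)
    (Lseq : ℕ → Matrix (Fin p) (Fin p) ℝ)
    (Δseq : ℕ → Matrix (Fin p) (Fin p) ℝ)
    (Mseq : ℕ → Matrix (Fin p × Fin p) (Fin p × Fin p) ℝ)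
    (αseq : ℕ → ℝ) (αmin : ℝ) (hαmin : 0 < αmin)
    (lammin lammax : ℝ) (hlammin : 1 / γ < lammin)
    (hLseq : ∀ t, Lseq t ∈ setF p ∧ 0 < (Lseq t + matJ p).det)
    (hMseq : ∀ t, (Mseq t).IsSymm ∧
      (Mseq t - lammin • (1 : Matrix (Fin p × Fin p) (Fin p × Fin p) ℝ)).PosSemidef ∧
      (lammax • (1 : Matrix (Fin p × Fin p) (Fin p × Fin p) ℝ) - Mseq t).PosSemidef)
    (hαseq : ∀ t, αmin ≤ αseq t ∧ αseq t ≤ 1)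
    (hΔfeas : ∀ t, (Δseq t).IsSymm ∧ Lseq t + Δseq t ∈ setF p)
    (hmin : ∀ t, ∀ Δ : Matrix (Fin p) (Fin p) ℝ, Δ.IsSymm → Lseq t + Δ ∈ setF p →
      (Δseq t * (S - (Lseq t + matJ p)⁻¹)).trace +
          (1 / 2) * (vecM (Δseq t) ⬝ᵥ Mseq t *ᵥ vecM (Δseq t)) +
          rhoMCP γ lam (Lseq t + Δseq t) ≤
        (Δ * (S - (Lseq t + matJ p)⁻¹)).trace +
          (1 / 2) * (vecM Δ ⬝ᵥ Mseq t *ᵥ vecM Δ) +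
          rhoMCP γ lam (Lseq t + Δ))
    (hupdate : ∀ t, Lseq (t + 1) = Lseq t + αseq t • Δseq t)
    (c : ℝ) (hc : 0 < c)
    (hdecrease : ∀ t, objF γ lam S (Lseq (t + 1)) ≤
      objF γ lam S (Lseq t) - c * ∑ i, ∑ j, Δseq t i j ^ 2)
    (Lbar : Matrix (Fin p) (Fin p) ℝ)
    (hlimit : ∃ φ : ℕ → ℕ, StrictMono φ ∧
      Filter.Tendsto (fun k => Lseq (φ k)) Filter.atTop (𝓝 Lbar))
    (hLbar : 0 < (Lbar + matJ p).det) :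
    ∀ D : Matrix (Fin p) (Fin p) ℝ, D.IsSymm → Lbar + D ∈ setF p →
      0 ≤ Filter.liminf
        (fun t : ℝ => (objF γ lam S (Lbar + t • D) - objF γ lam S Lbar) / t)
        (𝓝[>] (0 : ℝ)) := by
  intro D hD hLD
  obtain ⟨φ, hφ, hLφ⟩ := hlimit
  have hne : (Lbar + matJ p).det ≠ 0 := hLbar.ne'
  have hΔ : Tendsto Δseq atTop (𝓝 0) := by
    refine tendsto_zero_of_tendsto_sum_sq ?_
    have h := tendsto_zero_of_le_sub_succ (g := fun t => objF γ lam S (Lseq t))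
      (fun t => mul_nonneg hc.le (Finset.sum_nonneg fun i _ =>
        Finset.sum_nonneg fun j _ => sq_nonneg (Δseq t i j)))
      hdecrease hφ.tendsto_atTop ((continuousAt_objF hγ S hne).tendsto.comp hLφ)
    simpa [hc.ne'] using h.const_mul c⁻¹
  have hΔφ : Tendsto (fun k => Δseq (φ k)) atTop (𝓝 0) := hΔ.comp hφ.tendsto_atTop
  have hLbarF : Lbar ∈ setF p :=
    (isClosed_setF p).mem_of_tendsto hLφ (Eventually.of_forall fun k => (hLseq (φ k)).1)
  have hQ : Tendsto (fun k => S - (Lseq (φ k) + matJ p)⁻¹) atTop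
      (𝓝 (S - (Lbar + matJ p)⁻¹)) :=
    ((continuousAt_matrix_inv_of_det_ne_zero hne).tendsto.comp
      (hLφ.add_const (matJ p))).const_sub S
  have htrace : ∀ {A : ℕ → Matrix (Fin p) (Fin p) ℝ} {B}, Tendsto A atTop (𝓝 B) →
      Tendsto (fun k => (A k * (S - (Lseq (φ k) + matJ p)⁻¹)).trace) atTop
        (𝓝 (B * (S - (Lbar + matJ p)⁻¹)).trace) := fun hA =>
    (continuous_id.matrix_trace.tendsto _).comp (hA.mul hQ)
  refine liminf_objF_nonneg_of_model hγ hlam S hne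
    (b := 1 / 2 * (lammax * (vecM D ⬝ᵥ vecM D))) fun s hs hs1 => ?_
  have hseg : Lbar + s • D ∈ setF p := by
    have h := convex_setF p hLbarF hLD (sub_nonneg.mpr hs1) hs.le (sub_add_cancel 1 s)
    convert h using 1
    module
  have hstep : Tendsto (fun k => Lbar + s • D - Lseq (φ k)) atTop (𝓝 (s • D)) := by
    simpa using hLφ.const_sub (Lbar + s • D)
  have hnorm : Continuous fun A : Matrix (Fin p) (Fin p) ℝ =>
      1 / 2 * (lammax * (vecM A ⬝ᵥ vecM A)) := by
    unfold vecM dotProduct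
    fun_prop
  have hleft := (htrace hΔφ).add
    (((continuous_rhoMCP (lam := lam) hγ).tendsto _).comp (hLφ.add hΔφ))
  have hright := ((htrace hstep).add ((hnorm.tendsto _).comp hstep)).add_const
    (rhoMCP γ lam (Lbar + s • D))
  have hle := le_of_tendsto_of_tendsto' hleft hright fun k => by
    have hsum : Lseq (φ k) + (Lbar + s • D - Lseq (φ k)) = Lbar + s • D := by abel
    have h := hmin (φ k) (Lbar + s • D - Lseq (φ k)) (hseg.1.sub (hLseq (φ k)).1.1)
      (by rwa [hsum])
    rw [hsum] at h
    have hlo := quadForm_nonneg_of_lower_bound ((one_div_pos.mpr hγ).trans hlammin).le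
      (hMseq (φ k)).2.1 (vecM (Δseq (φ k)))
    have hhi := quadForm_le_of_upper_bound (hMseq (φ k)).2.2
      (vecM (Lbar + s • D - Lseq (φ k)))
    simp only [Function.comp_apply]
    linarith
  have hvec : vecM (s • D) = s • vecM D := rfl
  simp only [Matrix.zero_mul, Matrix.trace_zero, zero_add, add_zero, Matrix.smul_mul,
    Matrix.trace_smul, hvec, smul_dotProduct, dotProduct_smul, smul_eq_mul] at hle
  linarith
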